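/- arXiv:0904.2600 — 2 statements merged into one kernel-verified Lean document; each statement's English description precedes it below -/
import Mathlib

section
/- Let d be an even positive integer and (G,f_E) a connected finite e-labeled graph with labels in Z_d satisfying the even cycle property. Let C be any one cycle of odd length in G. If the odd cycle condition (d/2)·∑ f_E(e_l) = 0 in Z_d holds for C, then it holds for every cycle of odd length in G; i.e., (G,f_E) satisfies the odd cycle property if and only if the odd cycle condition holds for C. -/
open SimpleGraph Finset

/-- `fV` is a valid v-labeling of the e-labeled graph `(G, fE)`:
the label of each edge is the sum (mod `d`) of the labels of its endpoints. -/
def validVLabeling {V : Type*} {d : ℕ} (G : SimpleGraph V) (fE : Sym2 V → ZMod d)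
    (fV : V → ZMod d) : Prop :=
  ∀ ⦃u v : V⦄, G.Adj u v → fE s(u, v) = fV u + fV v

/-- `fE` is an additive e-labeling of `G`: some valid v-labeling exists. -/
def IsAdditive {V : Type*} {d : ℕ} (G : SimpleGraph V) (fE : Sym2 V → ZMod d) : Prop :=
  ∃ fV : V → ZMod d, validVLabeling G fE fV

/-- The even cycle property: for every cycle (closed walk) of even length,
the alternating sum of the labels of its edge sequence vanishes, i.e. the sum of the
labels at odd positions equals the sum of the labels at even positions. -/
def EvenCycleProperty {V : Type*} {d : ℕ} (G : SimpleGraph V) (fE : Sym2 V → ZMod d) : Prop :=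
  ∀ ⦃v : V⦄ (p : G.Walk v v), Even p.length → (p.edges.map fE).alternatingSum = 0

/-- The odd cycle property (for `d` even): for every cycle (closed walk) of odd length,
`(d/2) · (sum of the labels of its edges)` vanishes in `ZMod d`. -/
def OddCycleProperty {V : Type*} (d : ℕ) (G : SimpleGraph V) (fE : Sym2 V → ZMod d) : Prop :=
  ∀ ⦃v : V⦄ (p : G.Walk v v), Odd p.length →
    ((d / 2 : ℕ) : ZMod d) * (p.edges.map fE).sum = 0

/-- `(G, fE)` is compatible: if `d` is odd it has the even cycle property, and
if `d` is even it has both the even and the odd cycle properties. -/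
def Compatible {V : Type*} (d : ℕ) (G : SimpleGraph V) (fE : Sym2 V → ZMod d) : Prop :=
  (Odd d ∧ EvenCycleProperty G fE) ∨
  (Even d ∧ EvenCycleProperty G fE ∧ OddCycleProperty d G fE)

/-- A factor annihilated by `2` does not see the signs of an alternating sum. -/
theorem mul_alternatingSum_eq_mul_sum {R : Type*} [CommRing R] {a : R} (ha : a + a = 0)
    (l : List R) : a * l.alternatingSum = a * l.sum := by
  induction l with
  | nil => simp
  | cons x l ih =>
    rw [List.alternatingSum_cons, List.sum_cons, mul_sub, mul_add, ih]
    linear_combination (-l.sum) * ha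

/-- For `d` even and a connected e-labeled graph with the even cycle
property, the odd cycle property holds if and only if the odd cycle condition holds
for one given odd cycle `C`. -/
theorem oddCycleProperty_iff_of_one_cycle {V : Type*} [Fintype V] (d : ℕ) (hd : 0 < d)
    (hdeven : Even d) (G : SimpleGraph V) (fE : Sym2 V → ZMod d)
    (hconn : G.Connected) (heven : EvenCycleProperty G fE)
    {v : V} (C : G.Walk v v) (hodd : Odd C.length) :
    OddCycleProperty d G fE ↔ ((d / 2 : ℕ) : ZMod d) * (C.edges.map fE).sum = 0 := by
  refine ⟨fun h => h C hodd, fun hC w p hp => ?_⟩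
  have hhalf : ((d / 2 : ℕ) : ZMod d) + ((d / 2 : ℕ) : ZMod d) = 0 := by
    obtain ⟨k, rfl⟩ := hdeven
    rw [← Nat.cast_add, show (k + k) / 2 + (k + k) / 2 = k + k by omega, ZMod.natCast_self]
  obtain ⟨q⟩ := hconn.preconnected v w
  have hlen : Even (C.append (q.append (p.append q.reverse))).length := by
    simp only [Walk.length_append, Walk.length_reverse]
    grind
  have hsum := mul_alternatingSum_eq_mul_sum hhalf
    ((C.append (q.append (p.append q.reverse))).edges.map fE)
  rw [heven _ hlen] at hsum
  simp only [Walk.edges_append, Walk.edges_reverse, List.map_append, List.map_reverse,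
    List.sum_append, List.sum_reverse] at hsum
  linear_combination -hsum - hC - (q.edges.map fE).sum * hhalf
end

section
/- Let d be a positive integer and (G,f_E) a finite compatible e-labeled graph with labels in Z_d. If G' is a graph obtained from G by adding one new edge e (possibly together with one or both of its endpoints as new vertices), then there is an extension f'_E of f_E to the edges of G' (i.e. f'_E agrees with f_E on all edges of G and assigns some label in Z_d to e) such that (G',f'_E) is compatible. -/
open SimpleGraph Finset

theorem List.exists_sum_eq_alternatingSum_add_two_mul {R : Type*} [CommRing R] (l : List R) :
    ∃ c : R, l.sum = l.alternatingSum + 2 * c := by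
  induction l with
  | nil => exact ⟨0, by simp⟩
  | cons a l ih =>
    obtain ⟨c, hc⟩ := ih
    refine ⟨l.alternatingSum + c, ?_⟩
    rw [List.sum_cons, List.alternatingSum_cons, hc]
    ring

theorem ZMod.exists_eq_two_mul_of_odd {d : ℕ} (hd : Odd d) (a : ZMod d) :
    ∃ x, a = 2 * x := by
  obtain ⟨k, rfl⟩ := hd
  refine ⟨(k + 1) * a, ?_⟩
  have h : ((2 * k + 1 : ℕ) : ZMod (2 * k + 1)) = 0 := ZMod.natCast_self _
  push_cast at h
  linear_combination -a * h

theorem ZMod.exists_eq_two_mul_of_half_mul_eq_zero {d : ℕ} (hd : 0 < d) (hd' : Even d)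
    {a : ZMod d} (ha : ((d / 2 : ℕ) : ZMod d) * a = 0) : ∃ x, a = 2 * x := by
  have : NeZero d := ⟨hd.ne'⟩
  obtain ⟨k, hk⟩ := hd'
  have hdiv : d / 2 = k := by omega
  rw [hdiv, ← ZMod.natCast_zmod_val a, ← Nat.cast_mul, ZMod.natCast_eq_zero_iff] at ha
  have hdvd : k * 2 ∣ k * a.val := by rwa [show k * 2 = d by omega]
  obtain ⟨c, hc⟩ := Nat.dvd_of_mul_dvd_mul_left (by omega) hdvd
  exact ⟨c, by rw [← ZMod.natCast_zmod_val a, hc]; push_cast; rfl⟩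

section Labeling

variable {V : Type*} {d : ℕ} {G : SimpleGraph V} {fE : Sym2 V → ZMod d} {fV : V → ZMod d}

theorem validVLabeling.alternatingSum_edges (h : validVLabeling G fE fV) {u v : V}
    (p : G.Walk u v) :
    (p.edges.map fE).alternatingSum = fV u - (-1) ^ p.length * fV v := by
  induction p with
  | nil => simp
  | cons hadj p ih =>
    rw [Walk.edges_cons, List.map_cons, List.alternatingSum_cons, ih, h hadj, Walk.length_cons]
    ring

theorem validVLabeling.exists_sum_edges (h : validVLabeling G fE fV) {u v : V}
    (p : G.Walk u v) :
    ∃ c, (p.edges.map fE).sum = fV v - fV u + 2 * c := by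
  induction p with
  | nil => exact ⟨0, by simp⟩
  | @cons u w v hadj p ih =>
    obtain ⟨c, hc⟩ := ih
    refine ⟨fV u + c, ?_⟩
    rw [Walk.edges_cons, List.map_cons, List.sum_cons, hc, h hadj]
    ring

theorem IsAdditive.compatible (h : IsAdditive G fE) : Compatible d G fE := by
  obtain ⟨fV, h⟩ := h
  have heven : EvenCycleProperty G fE := fun v p hp => by
    rw [h.alternatingSum_edges, hp.neg_one_pow, one_mul, sub_self]
  rcases Nat.even_or_odd d with hd | hd
  · refine Or.inr ⟨hd, heven, fun v p _ => ?_⟩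
    obtain ⟨c, hc⟩ := h.exists_sum_edges p
    have hcast : ((d / 2 : ℕ) : ZMod d) * 2 = 0 := by
      have := congrArg (Nat.cast : ℕ → ZMod d) (Nat.div_mul_cancel hd.two_dvd)
      simpa using this
    rw [hc, sub_self, zero_add, ← mul_assoc, hcast, zero_mul]
  · exact Or.inl ⟨hd, heven⟩

theorem Compatible.evenCycleProperty (h : Compatible d G fE) : EvenCycleProperty G fE :=
  h.elim And.right fun h => h.2.1

theorem SimpleGraph.Walk.alternatingSum_edges_append (f : Sym2 V → ZMod d) {u v w : V}
    (p : G.Walk u v) (q : G.Walk v w) :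
    ((p.append q).edges.map f).alternatingSum =
      (p.edges.map f).alternatingSum + (-1) ^ p.length * (q.edges.map f).alternatingSum := by
  induction p with
  | nil => simp
  | cons hadj p ih =>
    simp only [Walk.cons_append, Walk.edges_cons, List.map_cons, List.alternatingSum_cons, ih,
      Walk.length_cons]
    ring

theorem SimpleGraph.Walk.alternatingSum_edges_reverse (f : Sym2 V → ZMod d) {u v : V}
    (p : G.Walk u v) :
    (p.reverse.edges.map f).alternatingSum =
      -(-1) ^ p.length * (p.edges.map f).alternatingSum := by
  induction p with
  | nil => simp
  | @cons u w v hadj p ih =>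
    simp only [Walk.reverse_cons, alternatingSum_edges_append, ih, Walk.edges_cons,
      Walk.edges_nil, List.map_cons, List.map_nil, List.alternatingSum_cons, Walk.length_cons,
      Walk.length_reverse, List.alternatingSum_nil, Sym2.eq_swap (a := w)]
    ring

/-- In a compatible graph, the alternating sums of the odd closed walks at `r` share a common
half, which serves as a label of `r`. -/
theorem Compatible.exists_root_label (hd : 0 < d) (h : Compatible d G fE) (r : V) :
    ∃ x, ∀ p : G.Walk r r, Odd p.length → (p.edges.map fE).alternatingSum = 2 * x := by
  by_cases hex : ∃ p : G.Walk r r, Odd p.length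
  · obtain ⟨p, hp⟩ := hex
    have hx : ∃ x, (p.edges.map fE).alternatingSum = 2 * x := by
      rcases h with ⟨hodd, -⟩ | ⟨heven, -, hsum⟩
      · exact ZMod.exists_eq_two_mul_of_odd hodd _
      · obtain ⟨y, hy⟩ := ZMod.exists_eq_two_mul_of_half_mul_eq_zero hd heven (hsum p hp)
        obtain ⟨c, hc⟩ := (p.edges.map fE).exists_sum_eq_alternatingSum_add_two_mul
        exact ⟨y - c, by linear_combination hy - hc⟩
    obtain ⟨x, hx⟩ := hx
    refine ⟨x, fun q hq => ?_⟩
    have hpq := h.evenCycleProperty (p.append q) (by rw [Walk.length_append]; exact hp.add_odd hq)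
    rw [Walk.alternatingSum_edges_append, hp.neg_one_pow] at hpq
    linear_combination hx - hpq
  · exact ⟨0, fun p hp => (hex ⟨p, hp⟩).elim⟩

/-- The label of `v` obtained by propagating the label `x` of `r` along a walk from `v` to `r`
does not depend on the walk. -/
theorem EvenCycleProperty.propagated_label_eq (h : EvenCycleProperty G fE) {r : V} {x : ZMod d}
    (hx : ∀ p : G.Walk r r, Odd p.length → (p.edges.map fE).alternatingSum = 2 * x) {v : V}
    (p q : G.Walk v r) :
    (p.edges.map fE).alternatingSum + (-1) ^ p.length * x =
      (q.edges.map fE).alternatingSum + (-1) ^ q.length * x := by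
  have heven := h (p.append q.reverse)
  have hodd := hx (p.reverse.append q)
  rw [Walk.length_append, Walk.length_reverse, Walk.alternatingSum_edges_append,
    Walk.alternatingSum_edges_reverse] at heven hodd
  rw [Walk.length_reverse] at hodd
  rcases Nat.even_or_odd p.length with hp | hp <;> rcases Nat.even_or_odd q.length with hq | hq
  · have := heven (hp.add hq)
    rw [hp.neg_one_pow, hq.neg_one_pow] at *
    linear_combination this
  · have := hodd (hp.add_odd hq)
    rw [hp.neg_one_pow] at *
    rw [hq.neg_one_pow]
    linear_combination -this
  · have := hodd (hp.add_even hq)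
    rw [hp.neg_one_pow] at *
    rw [hq.neg_one_pow]
    linear_combination this
  · have := heven (hp.add_odd hq)
    rw [hp.neg_one_pow, hq.neg_one_pow] at *
    linear_combination this

theorem Compatible.isAdditive (hd : 0 < d) (h : Compatible d G fE) : IsAdditive G fE := by
  choose x hx using h.exists_root_label hd
  let root (v : V) : V := (G.connectedComponentMk v).out
  have hroot (v : V) : Nonempty (G.Walk v (root v)) :=
    ConnectedComponent.exact (Quot.out_eq (G.connectedComponentMk v)).symm
  let path (v : V) : G.Walk v (root v) := (hroot v).some
  let fV (v : V) : ZMod d :=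
    ((path v).edges.map fE).alternatingSum + (-1) ^ (path v).length * x (root v)
  have hfV {v r : V} (hr : root v = r) (p : G.Walk v r) :
      fV v = (p.edges.map fE).alternatingSum + (-1) ^ p.length * x r := by
    subst hr
    exact h.evenCycleProperty.propagated_label_eq (hx _) _ _
  refine ⟨fV, fun u v hadj => ?_⟩
  have huv : root u = root v :=
    congrArg Quot.out (ConnectedComponent.sound hadj.reachable)
  rw [hfV huv (Walk.cons hadj (path v)), hfV rfl (path v), Walk.edges_cons, List.map_cons,
    List.alternatingSum_cons, Walk.length_cons]
  ring

end Labeling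

/-- If `(G, fE)` is compatible and `G'` is obtained from `G` by adding
one new edge `e` (new endpoints, if any, being isolated vertices of `G`), then `fE` can be
extended to the edges of `G'` so that the result is compatible. -/
theorem compatible_extend_edge {V : Type*} [Fintype V] (d : ℕ) (hd : 0 < d)
    (G G' : SimpleGraph V) (e : Sym2 V)
    (hnew : e ∉ G.edgeSet) (hedges : G'.edgeSet = insert e G.edgeSet)
    (fE : Sym2 V → ZMod d) (hcomp : Compatible d G fE) :
    ∃ fE' : Sym2 V → ZMod d,
      (∀ e' ∈ G.edgeSet, fE' e' = fE e') ∧ Compatible d G' fE' := by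
  obtain ⟨fV, hfV⟩ := hcomp.isAdditive hd
  refine ⟨Sym2.lift ⟨fun u v => fV u + fV v, fun u v => add_comm _ _⟩, fun e' => ?_,
    IsAdditive.compatible ⟨fV, fun _ _ _ => rfl⟩⟩
  induction e' with
  | _ u v => exact fun hadj => (hfV hadj).symm
end
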